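/- Let u : [0,1] → [0,∞) be a measurable function and suppose there exist 0 < p ≤ q < 1 and constants C₁ ≥ C₂ > 0 such that u(x) ≥ C₁ for a.e. x ∈ [0,p), C₂ ≤ u(x) ≤ C₁ for a.e. x ∈ [p,q), and u(x) ≤ C₂ for a.e. x ∈ [q,1]. Then u*(t) = (u·χ_{[0,p)})*(t) for all t ∈ [0,p), u*(t) = (u·χ_{[p,q)})*(t − p) for all t ∈ [p,q), and u*(t) = (u·χ_{[q,1]})*(t − q) for all t ∈ [q,1]. In particular, ∫₀ᵖ u*(s) ds = ∫₀ᵖ u(z) dz, ∫_p^q u*(s) ds = ∫_p^q u(z) dz, and ∫_q^1 u*(s) ds = ∫_q^1 u(z) dz. -/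

import Mathlib

open MeasureTheory ENNReal

/-- The distribution function `λ_f(s) = μ({x : |f(x)| > s})`. -/
noncomputable def distFn {α : Type*} [MeasurableSpace α] (μ : Measure α) (f : α → ℝ)
    (s : ℝ) : ℝ≥0∞ :=
  μ {x | s < |f x|}

/-- The nonincreasing rearrangement `f*(t) = inf{s > 0 : λ_f(s) ≤ t}` (with value `∞` if no
such `s` exists). -/
noncomputable def rearr {α : Type*} [MeasurableSpace α] (μ : Measure α) (f : α → ℝ)
    (t : ℝ) : ℝ≥0∞ :=
  sInf (ENNReal.ofReal '' {s : ℝ | 0 < s ∧ distFn μ f s ≤ ENNReal.ofReal t})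
theorem distFn_antitone {α : Type*} [MeasurableSpace α] (μ : Measure α) (f : α → ℝ) :
    Antitone (distFn μ f) := fun _ _ hst =>
  measure_mono fun _ hx => lt_of_le_of_lt hst hx

/-- The rearrangement depends only on the admissible levels. -/
theorem rearr_congr {α : Type*} [MeasurableSpace α] {μ : Measure α} {f g : α → ℝ} {t t' : ℝ}
    (h : ∀ s, 0 < s →
      (distFn μ f s ≤ ENNReal.ofReal t ↔ distFn μ g s ≤ ENNReal.ofReal t')) :
    rearr μ f t = rearr μ g t' := by
  unfold rearr
  congr 2
  ext s
  exact and_congr_right (h s)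

/-- The rearrangement at `t` is the length of the set of levels whose distribution function
exceeds `t`. -/
theorem rearr_eq_volume {α : Type*} [MeasurableSpace α] (μ : Measure α) (f : α → ℝ) (t : ℝ) :
    rearr μ f t = volume {s : ℝ | 0 < s ∧ ENNReal.ofReal t < distFn μ f s} := by
  apply le_antisymm
  · refine ENNReal.le_of_forall_pos_le_add fun ε hε hfin => ?_
    set v := volume {s : ℝ | 0 < s ∧ ENNReal.ofReal t < distFn μ f s} with hv
    have hε' : (0 : ℝ) < ε := hε
    have hr : 0 < v.toReal + ε := by positivity
    have hmem : distFn μ f (v.toReal + ε) ≤ ENNReal.ofReal t := by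
      by_contra! hlt
      have hsub : Set.Ioc 0 (v.toReal + ε) ⊆
          {s : ℝ | 0 < s ∧ ENNReal.ofReal t < distFn μ f s} := fun s hs =>
        ⟨hs.1, hlt.trans_le (distFn_antitone μ f hs.2)⟩
      have hle := measure_mono (μ := volume) hsub
      rw [Real.volume_Ioc, ← hv, sub_zero,
        ENNReal.ofReal_le_iff_le_toReal hfin.ne] at hle
      linarith
    have hle : rearr μ f t ≤ ENNReal.ofReal (v.toReal + ε) :=
      sInf_le (Set.mem_image_of_mem _ ⟨hr, hmem⟩)
    refine hle.trans ?_
    rw [ENNReal.ofReal_add ENNReal.toReal_nonneg hε'.le, ENNReal.ofReal_toReal hfin.ne,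
      ENNReal.ofReal_coe_nnreal]
  · refine le_sInf ?_
    rintro _ ⟨r, ⟨-, hr⟩, rfl⟩
    have hsub : {s : ℝ | 0 < s ∧ ENNReal.ofReal t < distFn μ f s} ⊆ Set.Ioo 0 r :=
      fun s hs => ⟨hs.1, by
        by_contra! hrs
        exact absurd hs.2 (not_lt.2 ((distFn_antitone μ f hrs).trans hr))⟩
    simpa using measure_mono (μ := volume) hsub

theorem volume_Ioo_inter_ofReal_lt {L : ℝ} {c : ℝ≥0∞} (hc : c ≤ ENNReal.ofReal L) :
    volume ({t : ℝ | ENNReal.ofReal t < c} ∩ Set.Ioo 0 L) = c := by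
  have hfin : c ≠ ∞ := ne_top_of_le_ne_top ENNReal.ofReal_ne_top hc
  have hset : {t : ℝ | ENNReal.ofReal t < c} ∩ Set.Ioo 0 L = Set.Ioo 0 c.toReal := by
    ext t
    simp only [Set.mem_inter_iff, Set.mem_ofPred_eq, Set.mem_Ioo]
    constructor
    · rintro ⟨h, h0, -⟩
      exact ⟨h0, (ENNReal.ofReal_lt_iff_lt_toReal h0.le hfin).1 h⟩
    · rintro ⟨h0, h⟩
      have h' := (ENNReal.ofReal_lt_iff_lt_toReal h0.le hfin).2 h
      exact ⟨h', h0, lt_of_not_ge fun hL =>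
        absurd (h'.trans_le hc) (not_lt.2 (ENNReal.ofReal_le_ofReal hL))⟩
  rw [hset, Real.volume_Ioo, sub_zero, ENNReal.ofReal_toReal hfin]

/-- Equimeasurability: a function whose support has measure at most `L` has the same integral
as its rearrangement on `(0, L)`. -/
theorem lintegral_rearr {α : Type*} [MeasurableSpace α] (μ : Measure α) {f : α → ℝ}
    (hf : Measurable f) {L : ℝ} (hL : ∀ s, 0 < s → distFn μ f s ≤ ENNReal.ofReal L) :
    ∫⁻ t in Set.Ioo 0 L, rearr μ f t = ∫⁻ x, ENNReal.ofReal |f x| ∂μ := by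
  rw [lintegral_eq_lintegral_meas_lt μ (Filter.Eventually.of_forall fun x => abs_nonneg (f x))
    hf.abs.aemeasurable]
  have hmeas : MeasurableSet {z : ℝ × ℝ | ENNReal.ofReal z.1 < distFn μ f z.2} :=
    measurableSet_lt (ENNReal.measurable_ofReal.comp measurable_fst)
      ((distFn_antitone μ f).measurable.comp measurable_snd)
  have hleft : ∀ t, rearr μ f t = volume.restrict (Set.Ioi (0 : ℝ))
      (Prod.mk t ⁻¹' {z : ℝ × ℝ | ENNReal.ofReal z.1 < distFn μ f z.2}) := fun t => by
    rw [rearr_eq_volume, Measure.restrict_apply (measurable_prodMk_left hmeas), Set.inter_comm]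
    rfl
  simp_rw [hleft]
  rw [← Measure.prod_apply hmeas, Measure.prod_apply_symm hmeas]
  refine setLIntegral_congr_fun measurableSet_Ioi fun s hs => ?_
  rw [Measure.restrict_apply (measurable_prodMk_right hmeas)]
  exact volume_Ioo_inter_ofReal_lt (hL s hs)

theorem distFn_restrict_indicator {α : Type*} [MeasurableSpace α] (μ : Measure α) {u : α → ℝ}
    (hu : Measurable u) {I E : Set α} (hE : MeasurableSet E) (hEI : E ⊆ I) {s : ℝ}
    (hs : 0 < s) :
    distFn (μ.restrict I) (E.indicator u) s = μ (E ∩ {x | s < |u x|}) := by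
  rw [distFn, Measure.restrict_apply
    (measurableSet_lt measurable_const (hu.indicator hE).abs)]
  congr 1
  ext x
  by_cases hx : x ∈ E
  · simp [hx, hEI hx]
  · simp [hx, hs.le]

/-- The rearrangement of the restriction of `u` to a set `E` integrates to `∫ |u|` over `E`. -/
theorem lintegral_rearr_indicator {α : Type*} [MeasurableSpace α] (μ : Measure α) {u : α → ℝ}
    (hu : Measurable u) {I E : Set α} (hE : MeasurableSet E) (hEI : E ⊆ I)
    {L : ℝ} (hL : μ E ≤ ENNReal.ofReal L) :
    ∫⁻ t in Set.Ioo 0 L, rearr (μ.restrict I) (E.indicator u) t =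
      ∫⁻ x in E, ENNReal.ofReal |u x| ∂μ := by
  rw [lintegral_rearr _ (hu.indicator hE) fun s hs => by
    rw [distFn_restrict_indicator μ hu hE hEI hs]
    exact (measure_mono Set.inter_subset_left).trans hL]
  have h : (fun x => ENNReal.ofReal |E.indicator u x|) =
      E.indicator fun x => ENNReal.ofReal |u x| := by
    ext x
    by_cases hx : x ∈ E <;> simp [hx]
  rw [h, lintegral_indicator hE, Measure.restrict_restrict hE, Set.inter_eq_left.2 hEI]

theorem setLIntegral_Ioo_comp_sub (g : ℝ → ℝ≥0∞) (a b : ℝ) :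
    ∫⁻ t in Set.Ioo a b, g (t - a) = ∫⁻ t in Set.Ioo 0 (b - a), g t := by
  have h := (measurePreserving_sub_right volume a).setLIntegral_comp_preimage_emb
    (MeasurableEquiv.subRight a).measurableEmbedding g (Set.Ioo 0 (b - a))
  simpa using h

theorem measure_inter_eq_self_of_ae {α : Type*} [MeasurableSpace α] {μ : Measure α}
    {E S : Set α} (h : ∀ᵐ x ∂μ, x ∈ E → x ∈ S) : μ (E ∩ S) = μ E :=
  measure_congr <| by
    filter_upwards [h] with x hx
    exact propext ⟨fun hh => hh.1, fun hh => ⟨hh, hx hh⟩⟩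

theorem measure_inter_eq_zero_of_ae {α : Type*} [MeasurableSpace α] {μ : Measure α}
    {E S : Set α} (h : ∀ᵐ x ∂μ, x ∈ E → x ∉ S) : μ (E ∩ S) = 0 := by
  rw [measure_eq_zero_iff_ae_notMem]
  filter_upwards [h] with x hx hh using hx hh.1 hh.2

theorem ofReal_add_le_ofReal_iff {a t : ℝ} (ha : 0 ≤ a) (hat : a ≤ t) (c : ℝ≥0∞) :
    ENNReal.ofReal a + c ≤ ENNReal.ofReal t ↔ c ≤ ENNReal.ofReal (t - a) := by
  have h : ENNReal.ofReal t = ENNReal.ofReal a + ENNReal.ofReal (t - a) := by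
    rw [← ENNReal.ofReal_add ha (sub_nonneg.2 hat), add_sub_cancel]
  rw [h, ENNReal.add_le_add_iff_left ENNReal.ofReal_ne_top]

/-- Splitting of the nonincreasing rearrangement of a function `u` on `[0,1]` which is
(essentially) separated into three levels on `[0,p)`, `[p,q)`, `[q,1]`. -/
theorem rearr_split (u : ℝ → ℝ) (hu : Measurable u)
    (hu0 : ∀ x ∈ Set.Icc (0 : ℝ) 1, 0 ≤ u x)
    (p q C₁ C₂ : ℝ) (hp : 0 < p) (hpq : p ≤ q) (hq : q < 1) (hC : C₂ ≤ C₁) (hC2 : 0 < C₂)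
    (h1 : ∀ᵐ x : ℝ, x ∈ Set.Ico (0 : ℝ) p → C₁ ≤ u x)
    (h2 : ∀ᵐ x : ℝ, x ∈ Set.Ico p q → C₂ ≤ u x ∧ u x ≤ C₁)
    (h3 : ∀ᵐ x : ℝ, x ∈ Set.Icc q 1 → u x ≤ C₂) :
    (∀ t ∈ Set.Ico (0 : ℝ) p,
        rearr (volume.restrict (Set.Icc (0 : ℝ) 1)) u t =
          rearr (volume.restrict (Set.Icc (0 : ℝ) 1)) ((Set.Ico (0 : ℝ) p).indicator u) t) ∧
    (∀ t ∈ Set.Ico p q,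
        rearr (volume.restrict (Set.Icc (0 : ℝ) 1)) u t =
          rearr (volume.restrict (Set.Icc (0 : ℝ) 1)) ((Set.Ico p q).indicator u) (t - p)) ∧
    (∀ t ∈ Set.Icc q 1,
        rearr (volume.restrict (Set.Icc (0 : ℝ) 1)) u t =
          rearr (volume.restrict (Set.Icc (0 : ℝ) 1)) ((Set.Icc q 1).indicator u) (t - q)) ∧
    (∫⁻ s in Set.Ioo 0 p, rearr (volume.restrict (Set.Icc (0 : ℝ) 1)) u s =
        ∫⁻ z in Set.Ioo 0 p, ENNReal.ofReal (u z)) ∧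
    (∫⁻ s in Set.Ioo p q, rearr (volume.restrict (Set.Icc (0 : ℝ) 1)) u s =
        ∫⁻ z in Set.Ioo p q, ENNReal.ofReal (u z)) ∧
    (∫⁻ s in Set.Ioo q 1, rearr (volume.restrict (Set.Icc (0 : ℝ) 1)) u s =
        ∫⁻ z in Set.Ioo q 1, ENNReal.ofReal (u z)) := by
  have hAI : Set.Ico 0 p ⊆ Set.Icc (0 : ℝ) 1 := fun x hx => ⟨hx.1, by linarith [hx.2]⟩
  have hBI : Set.Ico p q ⊆ Set.Icc (0 : ℝ) 1 := fun x hx =>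
    ⟨by linarith [hx.1], by linarith [hx.2]⟩
  have hDI : Set.Icc q 1 ⊆ Set.Icc (0 : ℝ) 1 := fun x hx => ⟨by linarith [hx.1], hx.2⟩
  have hS : ∀ s : ℝ, MeasurableSet {x | s < |u x|} := fun s =>
    measurableSet_lt measurable_const hu.abs
  have hsplit : ∀ s : ℝ, distFn (volume.restrict (Set.Icc (0 : ℝ) 1)) u s =
      volume (Set.Ico 0 p ∩ {x | s < |u x|}) + volume (Set.Ico p q ∩ {x | s < |u x|}) +
        volume (Set.Icc q 1 ∩ {x | s < |u x|}) := by
    intro s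
    have hI : Set.Icc (0 : ℝ) 1 = (Set.Ico 0 p ∪ Set.Ico p q) ∪ Set.Icc q 1 := by
      rw [Set.Ico_union_Ico_eq_Ico hp.le hpq, Set.Ico_union_Icc_eq_Icc (hp.le.trans hpq) hq.le]
    rw [distFn, Measure.restrict_apply (hS s), Set.inter_comm, hI, Set.union_inter_distrib_right,
      Set.union_inter_distrib_right,
      measure_union _ (measurableSet_Icc.inter (hS s)),
      measure_union _ (measurableSet_Ico.inter (hS s))]
    · exact Set.disjoint_left.2 fun x hx hy => absurd hx.1.2 (not_lt.2 hy.1.1)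
    · refine Set.disjoint_left.2 fun x hx hy => ?_
      rcases hx with hx | hx
      · linarith [hx.1.2, hy.1.1]
      · linarith [hx.1.2, hy.1.1]
  have hAlow : ∀ s < C₁, volume (Set.Ico 0 p ∩ {x | s < |u x|}) = ENNReal.ofReal p := by
    intro s hs
    rw [measure_inter_eq_self_of_ae, Real.volume_Ico, sub_zero]
    filter_upwards [h1] with x hx hxA
    exact hs.trans_le ((hx hxA).trans (le_abs_self _))
  have hBhigh : ∀ s, C₁ ≤ s → volume (Set.Ico p q ∩ {x | s < |u x|}) = 0 := by
    intro s hs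
    refine measure_inter_eq_zero_of_ae ?_
    filter_upwards [h2] with x hx hxB
    simpa [abs_of_nonneg (hu0 x (hBI hxB))] using (hx hxB).2.trans hs
  have hBlow : ∀ s < C₂, volume (Set.Ico p q ∩ {x | s < |u x|}) = ENNReal.ofReal (q - p) := by
    intro s hs
    rw [measure_inter_eq_self_of_ae, Real.volume_Ico]
    filter_upwards [h2] with x hx hxB
    exact hs.trans_le ((hx hxB).1.trans (le_abs_self _))
  have hDhigh : ∀ s, C₂ ≤ s → volume (Set.Icc q 1 ∩ {x | s < |u x|}) = 0 := by
    intro s hs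
    refine measure_inter_eq_zero_of_ae ?_
    filter_upwards [h3] with x hx hxD
    simpa [abs_of_nonneg (hu0 x (hDI hxD))] using (hx hxD).trans hs
  have hA_le : ∀ s, volume (Set.Ico 0 p ∩ {x | s < |u x|}) ≤ ENNReal.ofReal p := fun s =>
    (measure_mono Set.inter_subset_left).trans (by simp)
  have hB_le : ∀ s, volume (Set.Ico p q ∩ {x | s < |u x|}) ≤ ENNReal.ofReal (q - p) := fun s =>
    (measure_mono Set.inter_subset_left).trans (by simp)
  have hpq' : ENNReal.ofReal p + ENNReal.ofReal (q - p) = ENNReal.ofReal q := by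
    rw [← ENNReal.ofReal_add hp.le (sub_nonneg.2 hpq), add_sub_cancel]
  have hA : ∀ t ∈ Set.Ico (0 : ℝ) p,
      rearr (volume.restrict (Set.Icc (0 : ℝ) 1)) u t =
        rearr (volume.restrict (Set.Icc (0 : ℝ) 1)) ((Set.Ico (0 : ℝ) p).indicator u) t := by
    intro t ht
    refine rearr_congr fun s hs => ?_
    rw [hsplit, distFn_restrict_indicator _ hu measurableSet_Ico hAI hs]
    rcases lt_or_ge s C₁ with h | h
    · have hlt : ENNReal.ofReal t < ENNReal.ofReal p := (ENNReal.ofReal_lt_ofReal_iff hp).2 ht.2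
      rw [hAlow s h, add_assoc]
      exact iff_of_false (not_le.2 (hlt.trans_le le_self_add)) (not_le.2 hlt)
    · rw [hBhigh s h, hDhigh s (hC.trans h), add_zero, add_zero]
  have hB : ∀ t ∈ Set.Ico p q,
      rearr (volume.restrict (Set.Icc (0 : ℝ) 1)) u t =
        rearr (volume.restrict (Set.Icc (0 : ℝ) 1)) ((Set.Ico p q).indicator u) (t - p) := by
    intro t ht
    refine rearr_congr fun s hs => ?_
    rw [hsplit, distFn_restrict_indicator _ hu measurableSet_Ico hBI hs]
    rcases lt_or_ge s C₁ with h | h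
    · rw [hAlow s h]
      rcases lt_or_ge s C₂ with h' | h'
      · rw [hBlow s h', hpq']
        refine iff_of_false (not_le.2 ?_) (not_le.2 ?_)
        · exact ((ENNReal.ofReal_lt_ofReal_iff (hp.trans_le hpq)).2 ht.2).trans_le le_self_add
        · exact (ENNReal.ofReal_lt_ofReal_iff (by linarith [ht.1, ht.2])).2 (by linarith [ht.2])
      · rw [hDhigh s h', add_zero, ofReal_add_le_ofReal_iff hp.le ht.1]
    · rw [hBhigh s h, hDhigh s (hC.trans h), add_zero, add_zero]
      exact iff_of_true ((hA_le s).trans (ENNReal.ofReal_le_ofReal ht.1)) zero_le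
  have hD : ∀ t ∈ Set.Icc q 1,
      rearr (volume.restrict (Set.Icc (0 : ℝ) 1)) u t =
        rearr (volume.restrict (Set.Icc (0 : ℝ) 1)) ((Set.Icc q 1).indicator u) (t - q) := by
    intro t ht
    refine rearr_congr fun s hs => ?_
    rw [hsplit, distFn_restrict_indicator _ hu measurableSet_Icc hDI hs]
    rcases lt_or_ge s C₂ with h | h
    · rw [hAlow s (h.trans_le hC), hBlow s h, hpq',
        ofReal_add_le_ofReal_iff (hp.le.trans hpq) ht.1]
    · rw [hDhigh s h, add_zero]
      refine iff_of_true ?_ zero_le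
      exact ((add_le_add (hA_le s) (hB_le s)).trans_eq hpq').trans
        (ENNReal.ofReal_le_ofReal ht.1)
  have habs : ∀ {E : Set ℝ}, MeasurableSet E → E ⊆ Set.Icc (0 : ℝ) 1 →
      ∫⁻ x in E, ENNReal.ofReal |u x| = ∫⁻ x in E, ENNReal.ofReal (u x) := fun hE hEI =>
    setLIntegral_congr_fun hE fun x hx => by simp only [abs_of_nonneg (hu0 x (hEI hx))]
  refine ⟨hA, hB, hD, ?_, ?_, ?_⟩
  · rw [setLIntegral_congr_fun measurableSet_Ioo fun t ht => hA t (Set.Ioo_subset_Ico_self ht),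
      lintegral_rearr_indicator _ hu measurableSet_Ico hAI (by simp),
      habs measurableSet_Ico hAI, setLIntegral_congr Ioo_ae_eq_Ico]
  · rw [setLIntegral_congr_fun measurableSet_Ioo fun t ht => hB t (Set.Ioo_subset_Ico_self ht),
      setLIntegral_Ioo_comp_sub, lintegral_rearr_indicator _ hu measurableSet_Ico hBI (by simp),
      habs measurableSet_Ico hBI, setLIntegral_congr Ioo_ae_eq_Ico]
  · rw [setLIntegral_congr_fun measurableSet_Ioo fun t ht => hD t (Set.Ioo_subset_Icc_self ht),
      setLIntegral_Ioo_comp_sub, lintegral_rearr_indicator _ hu measurableSet_Icc hDI (by simp),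
      habs measurableSet_Icc hDI, setLIntegral_congr Ioo_ae_eq_Icc]
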